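/- arXiv:2411.05567 — 7 statements merged into one kernel-verified Lean document; each statement's English description precedes it below -/
import Mathlib

section
/- Let ℓ : ℝ → ℝ be strictly increasing and positive on [w^r, ∞), let y > w^r and η ∈ (0,1). Suppose ŵ ≥ w^r maximizes the responsible firm's objective g_η(w) = ℓ(w)·(y − w + η(w − w^r)) over [w^r, ∞), and w̃ ≥ w^r maximizes the profit objective g_0(w) = ℓ(w)·(y − w) over [w^r, ∞), with w̃ > w^r. Then ŵ ≥ w̃. -/
/-- In the Burdett–Mortensen model, a responsible firm's optimal wage is at least
the profit-maximizing firm's optimal wage. -/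
theorem stmt_0 (ℓ : ℝ → ℝ) (wr y η what wtil : ℝ)
    (hmono : StrictMonoOn ℓ (Set.Ici wr))
    (hpos : ∀ w, wr ≤ w → 0 < ℓ w)
    (hy : wr < y) (hη0 : 0 < η) (hη1 : η < 1)
    (hwhat : wr ≤ what)
    (hwhatmax : ∀ w, wr ≤ w →
      ℓ w * (y - w + η * (w - wr)) ≤ ℓ what * (y - what + η * (what - wr)))
    (hwtil : wr ≤ wtil) (hwtilr : wr < wtil)
    (hwtilmax : ∀ w, wr ≤ w → ℓ w * (y - w) ≤ ℓ wtil * (y - wtil)) :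
    wtil ≤ what := by
  by_contra! hlt
  have hℓ : ℓ what < ℓ wtil := hmono hwhat hwtil hlt
  have hsurplus : ℓ what * (what - wr) < ℓ wtil * (wtil - wr) :=
    mul_lt_mul'' hℓ (by linarith) (hpos what hwhat).le (by linarith)
  have hη := mul_lt_mul_of_pos_left hsurplus hη0
  linarith [hwhatmax wtil hwtil, hwtilmax what hwhat]
end

section
/- Let ℓ : ℝ → ℝ be strictly increasing and let y₁ < y₂ be real numbers. Suppose w₁ and w₂ satisfy the equilibrium optimality inequalities ℓ(w₂)·(y₂ − w₂) ≥ ℓ(w₁)·(y₂ − w₁) and ℓ(w₁)·(y₁ − w₁) > ℓ(w₂)·(y₁ − w₂). Then w₂ > w₁. -/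
/-- In the Burdett–Mortensen model with two productivity types, the equilibrium
optimality inequalities imply the higher-productivity type posts the higher wage. -/
theorem stmt_1 (ℓ : ℝ → ℝ) (y₁ y₂ w₁ w₂ : ℝ)
    (hmono : StrictMono ℓ) (hy : y₁ < y₂)
    (h2 : ℓ w₁ * (y₂ - w₁) ≤ ℓ w₂ * (y₂ - w₂))
    (h1 : ℓ w₂ * (y₁ - w₂) < ℓ w₁ * (y₁ - w₁)) :
    w₁ < w₂ := by
  refine hmono.lt_iff_lt.mp ?_
  have h : ℓ w₁ * (y₂ - y₁) < ℓ w₂ * (y₂ - y₁) := by linarith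
  exact lt_of_mul_lt_mul_right h (sub_nonneg.mpr hy.le)
end

section
/- Let δ, λ > 0 and let w̲ ≤ w < y with w̲ < y. Suppose F ∈ [0, 1] satisfies the equal-profit condition (δλ / (δ + λ(1 − F))²)·(y − w) = (δλ / (δ + λ)²)·(y − w̲). Then F = ((δ + λ)/λ)·(1 − √((y − w)/(y − w̲))). -/
/-- Equal-profit condition pins down the Burdett–Mortensen wage distribution. -/
theorem stmt_2 (δ lam y wlow w F : ℝ)
    (hδ : 0 < δ) (hlam : 0 < lam)
    (h1 : wlow ≤ w) (h2 : w < y) (h3 : wlow < y)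
    (hF0 : 0 ≤ F) (hF1 : F ≤ 1)
    (heq : δ * lam / (δ + lam * (1 - F)) ^ 2 * (y - w)
         = δ * lam / (δ + lam) ^ 2 * (y - wlow)) :
    F = (δ + lam) / lam * (1 - Real.sqrt ((y - w) / (y - wlow))) := by
  have hsep : 0 < δ + lam * (1 - F) :=
    add_pos_of_pos_of_nonneg hδ (mul_nonneg hlam.le (sub_nonneg.2 hF1))
  have hsum : 0 < δ + lam := add_pos hδ hlam
  have hmargin : 0 < y - wlow := sub_pos.2 h3
  have hratio : (y - w) / (y - wlow) = ((δ + lam * (1 - F)) / (δ + lam)) ^ 2 := by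
    rw [div_mul_eq_mul_div, div_mul_eq_mul_div,
      div_eq_div_iff (pow_pos hsep 2).ne' (pow_pos hsum 2).ne'] at heq
    rw [div_pow, div_eq_div_iff hmargin.ne' (pow_pos hsum 2).ne']
    refine mul_left_cancel₀ (mul_pos hδ hlam).ne' ?_
    linear_combination heq
  rw [hratio, Real.sqrt_sq (div_pos hsep hsum).le]
  field_simp
  ring
end

section
/- Let δ, λ > 0, α ∈ (0,1), η ∈ [0,1), and w^r ≤ w̲₂ ≤ w < y with y − w + η(w − w^r) > 0 and y − w̲₂ + η(w̲₂ − w^r) > 0. Suppose F ∈ [α, 1] and F₂ ∈ [0,1] satisfy F = α + (1 − α)F₂ and the equal-surplus condition (δλ / (δ + λ(1 − F))²)·(y − w + η(w − w^r)) = (δλ / (δ + λ(1 − α))²)·(y − w̲₂ + η(w̲₂ − w^r)). Then F₂ = ((δ + λ(1 − α)) / (λ(1 − α)))·(1 − √((y − w + η(w − w^r))/(y − w̲₂ + η(w̲₂ − w^r)))). -/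
/-- Equal-stakeholder-value condition pins down the responsible firms' wage
distribution in the Burdett–Mortensen model. -/
theorem stmt_3 (δ lam α η wr wlow2 y w F F₂ : ℝ)
    (hδ : 0 < δ) (hlam : 0 < lam) (hα0 : 0 < α) (hα1 : α < 1)
    (hη0 : 0 ≤ η) (hη1 : η < 1)
    (h1 : wr ≤ wlow2) (h2 : wlow2 ≤ w) (h3 : w < y)
    (hpos1 : 0 < y - w + η * (w - wr)) (hpos2 : 0 < y - wlow2 + η * (wlow2 - wr))
    (hFa : α ≤ F) (hF1 : F ≤ 1) (hF₂0 : 0 ≤ F₂) (hF₂1 : F₂ ≤ 1)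
    (hFmix : F = α + (1 - α) * F₂)
    (heq : δ * lam / (δ + lam * (1 - F)) ^ 2 * (y - w + η * (w - wr))
         = δ * lam / (δ + lam * (1 - α)) ^ 2 * (y - wlow2 + η * (wlow2 - wr))) :
    F₂ = (δ + lam * (1 - α)) / (lam * (1 - α)) *
      (1 - Real.sqrt ((y - w + η * (w - wr)) / (y - wlow2 + η * (wlow2 - wr)))) := by
  have hA : 0 < δ + lam * (1 - F) := by
    have := mul_nonneg hlam.le (sub_nonneg.2 hF1)
    linarith
  have hd : 0 < 1 - α := sub_pos.2 hα1
  have hB : 0 < δ + lam * (1 - α) := by positivity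
  have hratio : (y - w + η * (w - wr)) / (y - wlow2 + η * (wlow2 - wr))
      = ((δ + lam * (1 - F)) / (δ + lam * (1 - α))) ^ 2 := by
    generalize y - w + η * (w - wr) = p at *
    generalize y - wlow2 + η * (wlow2 - wr) = q at *
    generalize δ + lam * (1 - F) = a at *
    generalize δ + lam * (1 - α) = b at *
    field_simp at heq ⊢
    linarith
  rw [hratio, Real.sqrt_sq (by positivity), one_sub_div hB.ne', div_mul_div_comm,
    eq_div_iff (by positivity), hFmix]
  ring
end

section
/- Let β ∈ (0,1), δ ∈ (0,1), q ∈ (0,1), κ > 0, and let y, w, w_R be real numbers with w_R > w. Suppose the free-entry condition for ordinary firms holds: κ·(1 − β(1 − δ)) = βq·(y − w). Let J_R and V_R satisfy the responsible firm's stationary Bellman equations J_R = y − w_R + β(δ·V_R + (1 − δ)·J_R) and V_R = −κ + β(q·J_R + (1 − q)·V_R). Then V_R < 0; in particular, no responsible firm enters the market in a free-entry equilibrium. -/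
/-- In a free-entry equilibrium, a responsible firm paying `wR > w` has a strictly
negative vacancy value, so no responsible firm enters the market. -/
theorem stmt_12 (β δ q κ y w wR JR VR : ℝ)
    (hβ : β ∈ Set.Ioo (0:ℝ) 1) (hδ : δ ∈ Set.Ioo (0:ℝ) 1) (hq : q ∈ Set.Ioo (0:ℝ) 1)
    (hκ : 0 < κ) (hwR : w < wR)
    (hfe : κ * (1 - β * (1 - δ)) = β * q * (y - w))
    (hJR : JR = y - wR + β * (δ * VR + (1 - δ) * JR))
    (hVR : VR = -κ + β * (q * JR + (1 - q) * VR)) :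
    VR < 0 := by
  obtain ⟨hβ0, hβ1⟩ := hβ
  obtain ⟨hδ0, -⟩ := hδ
  obtain ⟨hq0, -⟩ := hq
  have hdet : 0 < (1 - β) * (1 - β + β * δ + β * q) := by
    have : 0 < 1 - β := sub_pos.mpr hβ1
    positivity
  have hsolve : (1 - β) * (1 - β + β * δ + β * q) * VR = -(β * q * (wR - w)) := by
    linear_combination (1 - β * (1 - δ)) * hVR + β * q * hJR - hfe
  have hgap : 0 < β * q * (wR - w) := mul_pos (mul_pos hβ0 hq0) (sub_pos.mpr hwR)
  exact (pos_iff_neg_of_mul_neg (by linarith)).mp hdet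
end

section
/- Let 0 ≤ φ < φ_R < 1, E < 1, and F > 0 be real numbers, and for γ ∈ ℝ define D(γ) = 1 − φE − (1 − φ)(1 − γ)F, D'(γ) = 1 − φ_R·E − (1 − φ_R)·γ·F, d(γ) = (1 − φ)·γ·F, d'(γ) = (1 − φ_R)·(1 − γ)·F, and P(γ) = D(γ)·D'(γ) − d(γ)·d'(γ). Then P is an affine function of γ with P(γ₂) − P(γ₁) = F·(φ_R − φ)·(1 − E)·(γ₂ − γ₁) for all γ₁, γ₂; in particular P is strictly increasing. Consequently, for any constant K > 0, the wage gap γ ↦ K/P(γ) is strictly decreasing on any interval where P(γ) > 0. -/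
/-- The determinant `P(γ) = DD' - dd'` is affine and strictly increasing in the
fraction `γ` of responsible firms, so the wage gap `K/P(γ)` decreases in `γ`. -/
theorem stmt_17 (φ φR E F K : ℝ)
    (hφ0 : 0 ≤ φ) (hφ : φ < φR) (hφR : φR < 1) (hE : E < 1) (hF : 0 < F)
    (D Dp dd dp P : ℝ → ℝ)
    (hD : ∀ γ, D γ = 1 - φ * E - (1 - φ) * (1 - γ) * F)
    (hDp : ∀ γ, Dp γ = 1 - φR * E - (1 - φR) * γ * F)
    (hd : ∀ γ, dd γ = (1 - φ) * γ * F)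
    (hdp : ∀ γ, dp γ = (1 - φR) * (1 - γ) * F)
    (hP : ∀ γ, P γ = D γ * Dp γ - dd γ * dp γ) :
    (∀ γ₁ γ₂ : ℝ, P γ₂ - P γ₁ = F * (φR - φ) * (1 - E) * (γ₂ - γ₁)) ∧
    StrictMono P ∧
    (0 < K → ∀ γ₁ γ₂ : ℝ, γ₁ < γ₂ → 0 < P γ₁ → 0 < P γ₂ → K / P γ₂ < K / P γ₁) := by
  have affine : ∀ γ₁ γ₂ : ℝ, P γ₂ - P γ₁ = F * (φR - φ) * (1 - E) * (γ₂ - γ₁) := by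
    intro γ₁ γ₂
    simp only [hP, hD, hDp, hd, hdp]
    ring
  have mono : StrictMono P := by
    intro γ₁ γ₂ h
    have slope_pos : 0 < F * (φR - φ) * (1 - E) :=
      mul_pos (mul_pos hF (sub_pos.2 hφ)) (sub_pos.2 hE)
    rw [← sub_pos, affine]
    exact mul_pos slope_pos (sub_pos.2 h)
  exact ⟨affine, mono, fun hK _ _ h h₁ _ => div_lt_div_of_pos_left hK h₁ (mono h)⟩
end

section
/- Let ℓ : ℝ → ℝ be continuous, strictly increasing, and differentiable, with ℓ(w₀) = 0 for some w₀, and for w ≥ w₀ define the worker surplus S(w) = w·ℓ(w) − ∫₀^{ℓ(w)} ℓ⁻¹(l) dl, where ℓ⁻¹ is the inverse of ℓ. Then S is differentiable at every w > w₀ with S'(w) = ℓ(w). Consequently, if f : ℝ → ℝ is differentiable and w* > w₀ satisfies the stakeholder first-order condition f'(ℓ(w*))·ℓ'(w*) = ℓ(w*) + w*·ℓ'(w*) − S'(w*) with ℓ'(w*) ≠ 0, then f'(ℓ(w*)) = w*. -/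
/-- In the standard model, the worker surplus `S(w) = wℓ(w) - ∫₀^{ℓ(w)} ℓ⁻¹`
has derivative `ℓ(w)`, so the responsible firm's first-order condition implies
that the wage equals the marginal product of labor. -/
theorem stmt_18 (ℓ ℓ' ℓinv S : ℝ → ℝ) (w₀ : ℝ)
    (hcont : Continuous ℓ) (hmono : StrictMono ℓ)
    (hderiv : ∀ w, HasDerivAt ℓ (ℓ' w) w)
    (hw₀ : ℓ w₀ = 0)
    (hinvcont : Continuous ℓinv)
    (hinv : ∀ w, ℓinv (ℓ w) = w)
    (hS : ∀ w, S w = w * ℓ w - ∫ l in (0:ℝ)..(ℓ w), ℓinv l) :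
    (∀ w, w₀ < w → HasDerivAt S (ℓ w) w) ∧
    ∀ (f f' : ℝ → ℝ), (∀ x, HasDerivAt f (f' x) x) →
      ∀ wstar, w₀ < wstar → ℓ' wstar ≠ 0 →
        f' (ℓ wstar) * ℓ' wstar = ℓ wstar + wstar * ℓ' wstar - deriv S wstar →
        f' (ℓ wstar) = wstar := by
  have key (w : ℝ) : HasDerivAt S (ℓ w) w := by
    have hint : HasDerivAt (fun u => ∫ l in (0:ℝ)..u, ℓinv l) (ℓinv (ℓ w)) (ℓ w) :=
      (hinvcont.integral_hasStrictDerivAt 0 (ℓ w)).hasDerivAt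
    rw [hinv] at hint
    have h := ((hasDerivAt_id w).mul (hderiv w)).sub (hint.comp w (hderiv w))
    rw [funext hS]
    exact h.congr_deriv (by simp)
  refine ⟨fun w _ => key w, fun f f' _ wstar _ hne hfoc => ?_⟩
  rw [(key wstar).deriv] at hfoc
  exact mul_right_cancel₀ hne (by linarith)
end
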